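/- Let k be a positive integer, p ∈ (0,1), q = 1 − p, θ = 1 − q^k, and g(x) = 1 − (1−x)^{1/k}. For each positive integer n let V_n be the variance of g(S/n) where S ~ Binomial(n, θ), i.e. V_n = ∑_{j=0}^{n} C(n,j)θ^j(1−θ)^{n−j}·g(j/n)² − (∑_{j=0}^{n} C(n,j)θ^j(1−θ)^{n−j}·g(j/n))². Then n·V_n → v_k(q) as n → ∞, where v_k(q) = q²(q^{−k} − 1)/k². -/

import Mathlib

/-- The expectation of `f S` for `S ~ Binomial(n, θ)`. -/
def binomialMean (θ : ℝ) (n : ℕ) (f : ℕ → ℝ) : ℝ :=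
  ∑ j ∈ Finset.range (n + 1), (n.choose j : ℝ) * θ ^ j * (1 - θ) ^ (n - j) * f j

namespace binomialMean

variable {θ : ℝ} {n : ℕ}

lemma succ (θ : ℝ) (n : ℕ) (f : ℕ → ℝ) :
    binomialMean θ (n + 1) f =
      (1 - θ) * binomialMean θ n f + θ * binomialMean θ n (fun j => f (j + 1)) := by
  have key : ∀ (m : ℕ) (h : ℕ → ℝ), binomialMean θ m h =
      ∑ ij ∈ Finset.HasAntidiagonal.antidiagonal m,
        (m.choose ij.1 : ℝ) * (θ ^ ij.1 * (1 - θ) ^ ij.2 * h ij.1) := by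
    intro m h
    rw [Finset.Nat.sum_antidiagonal_eq_sum_range_succ
      (fun i j => (m.choose i : ℝ) * (θ ^ i * (1 - θ) ^ j * h i))]
    exact Finset.sum_congr rfl fun j _ => by ring
  rw [key, key, key, Finset.sum_antidiagonal_choose_succ_mul
    (fun i j => θ ^ i * (1 - θ) ^ j * f i), Finset.mul_sum, Finset.mul_sum]
  congr 1
  · exact Finset.sum_congr rfl fun ij _ => by ring
  · refine Finset.sum_congr rfl fun ij hij => ?_
    rw [Nat.choose_symm_of_eq_add (Finset.HasAntidiagonal.mem_antidiagonal.mp hij).symm]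
    ring

lemma succ_of_eq {f u v : ℕ → ℝ} {a b : ℝ} (hu : binomialMean θ n u = a)
    (hv : binomialMean θ n v = b) (hfu : ∀ j, f j = u j) (hfv : ∀ j, f (j + 1) = v j) :
    binomialMean θ (n + 1) f = (1 - θ) * a + θ * b := by
  rw [succ, funext hfu, ← hu, ← hv]
  simp only [← hfu, hfv]

lemma add (f g : ℕ → ℝ) :
    binomialMean θ n (fun j => f j + g j) = binomialMean θ n f + binomialMean θ n g := by
  simp only [binomialMean, mul_add, Finset.sum_add_distrib]

lemma const_mul (a : ℝ) (f : ℕ → ℝ) :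
    binomialMean θ n (fun j => a * f j) = a * binomialMean θ n f := by
  rw [binomialMean, binomialMean, Finset.mul_sum]
  exact Finset.sum_congr rfl fun j _ => by ring

lemma one (θ : ℝ) (n : ℕ) : binomialMean θ n (fun _ => 1) = 1 := by
  induction n with
  | zero => simp [binomialMean]
  | succ n ih => rw [succ, ih]; ring

lemma weight_nonneg (hθ : θ ∈ Set.Icc (0 : ℝ) 1) (j : ℕ) :
    0 ≤ (n.choose j : ℝ) * θ ^ j * (1 - θ) ^ (n - j) :=
  mul_nonneg (mul_nonneg (Nat.cast_nonneg _) (pow_nonneg hθ.1 _))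
    (pow_nonneg (sub_nonneg.mpr hθ.2) _)

lemma mono (hθ : θ ∈ Set.Icc (0 : ℝ) 1) {f g : ℕ → ℝ} (h : ∀ j ≤ n, f j ≤ g j) :
    binomialMean θ n f ≤ binomialMean θ n g :=
  Finset.sum_le_sum fun j hj => mul_le_mul_of_nonneg_left
    (h j (Nat.lt_succ_iff.mp (Finset.mem_range.mp hj))) (weight_nonneg hθ j)

lemma mul_sq_le (hθ : θ ∈ Set.Icc (0 : ℝ) 1) (f g : ℕ → ℝ) :
    binomialMean θ n (fun j => f j * g j) ^ 2 ≤
      binomialMean θ n (fun j => f j ^ 2) * binomialMean θ n (fun j => g j ^ 2) := by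
  refine Finset.sum_sq_le_sum_mul_sum_of_sq_le_mul _
    (fun j _ => mul_nonneg (weight_nonneg hθ j) (sq_nonneg _))
    (fun j _ => mul_nonneg (weight_nonneg hθ j) (sq_nonneg _)) fun j _ => le_of_eq (by ring)

lemma sq_le (hθ : θ ∈ Set.Icc (0 : ℝ) 1) (f : ℕ → ℝ) :
    binomialMean θ n f ^ 2 ≤ binomialMean θ n (fun j => f j ^ 2) := by
  simpa [one] using mul_sq_le (n := n) hθ f (fun _ => 1)

lemma centralMoment_one (θ : ℝ) (n : ℕ) : binomialMean θ n (fun j => j - n * θ) = 0 := by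
  induction n with
  | zero => simp [binomialMean]
  | succ n ih =>
    have h : ∀ t : ℝ, binomialMean θ n (fun j => ((j : ℝ) - n * θ) + t * 1) = t := by
      intro t; rw [add, const_mul, ih, one]; ring
    rw [succ_of_eq (h (-θ)) (h (1 - θ)) (fun j => by push_cast; ring)
      (fun j => by push_cast; ring)]
    ring

lemma centralMoment_two (θ : ℝ) (n : ℕ) :
    binomialMean θ n (fun j => (j - n * θ) ^ 2) = n * (θ * (1 - θ)) := by
  induction n with
  | zero => simp [binomialMean]
  | succ n ih =>
    have h : ∀ t : ℝ, binomialMean θ n (fun j => ((j : ℝ) - n * θ) ^ 2 +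
        (2 * t * (j - n * θ) + t ^ 2 * 1)) = n * (θ * (1 - θ)) + t ^ 2 := by
      intro t; rw [add, add, const_mul, const_mul, ih, centralMoment_one, one]; ring
    rw [succ_of_eq (h (-θ)) (h (1 - θ)) (fun j => by push_cast; ring)
      (fun j => by push_cast; ring)]
    push_cast
    ring

lemma centralMoment_three (θ : ℝ) (n : ℕ) :
    binomialMean θ n (fun j => (j - n * θ) ^ 3) = n * (θ * (1 - θ) * (1 - 2 * θ)) := by
  induction n with
  | zero => simp [binomialMean]
  | succ n ih =>
    have h : ∀ t : ℝ, binomialMean θ n (fun j => ((j : ℝ) - n * θ) ^ 3 +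
        (3 * t * (j - n * θ) ^ 2 + (3 * t ^ 2 * (j - n * θ) + t ^ 3 * 1))) =
        n * (θ * (1 - θ) * (1 - 2 * θ)) + 3 * t * (n * (θ * (1 - θ))) + t ^ 3 := by
      intro t
      rw [add, add, add, const_mul, const_mul, const_mul, ih, centralMoment_two,
        centralMoment_one, one]
      ring
    rw [succ_of_eq (h (-θ)) (h (1 - θ)) (fun j => by push_cast; ring)
      (fun j => by push_cast; ring)]
    push_cast
    ring

lemma centralMoment_four (θ : ℝ) (n : ℕ) :
    binomialMean θ n (fun j => (j - n * θ) ^ 4) =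
      3 * n ^ 2 * (θ * (1 - θ)) ^ 2 + n * (θ * (1 - θ) * (1 - 6 * (θ * (1 - θ)))) := by
  induction n with
  | zero => simp [binomialMean]
  | succ n ih =>
    have h : ∀ t : ℝ, binomialMean θ n (fun j => ((j : ℝ) - n * θ) ^ 4 +
        (4 * t * (j - n * θ) ^ 3 + (6 * t ^ 2 * (j - n * θ) ^ 2 +
          (4 * t ^ 3 * (j - n * θ) + t ^ 4 * 1)))) =
        3 * n ^ 2 * (θ * (1 - θ)) ^ 2 + n * (θ * (1 - θ) * (1 - 6 * (θ * (1 - θ)))) +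
          4 * t * (n * (θ * (1 - θ) * (1 - 2 * θ))) + 6 * t ^ 2 * (n * (θ * (1 - θ))) +
          t ^ 4 := by
      intro t
      rw [add, add, add, add, const_mul, const_mul, const_mul, const_mul, ih,
        centralMoment_three, centralMoment_two, centralMoment_one, one]
      ring
    rw [succ_of_eq (h (-θ)) (h (1 - θ)) (fun j => by push_cast; ring)
      (fun j => by push_cast; ring)]
    push_cast
    ring

lemma centralMoment_four_le (hθ : θ ∈ Set.Icc (0 : ℝ) 1) (n : ℕ) :
    binomialMean θ n (fun j => (j - n * θ) ^ 4) ≤ (n : ℝ) ^ 2 := by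
  have hs0 : 0 ≤ θ * (1 - θ) := mul_nonneg hθ.1 (sub_nonneg.mpr hθ.2)
  have hs1 : θ * (1 - θ) ≤ 1 / 4 := by nlinarith [sq_nonneg (2 * θ - 1)]
  have hn : (n : ℝ) ≤ (n : ℝ) ^ 2 := by
    exact_mod_cast Nat.le_self_pow two_ne_zero n
  rw [centralMoment_four]
  generalize θ * (1 - θ) = s at *
  have h1 : s * (1 - 6 * s) ≤ 1 / 4 := by nlinarith
  have h2 : s ^ 2 ≤ 1 / 16 := by nlinarith
  have h3 := mul_le_mul_of_nonneg_left h1 (Nat.cast_nonneg (α := ℝ) n)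
  have h4 := mul_le_mul_of_nonneg_left h2 (sq_nonneg (n : ℝ))
  nlinarith

/-- Decomposition of the variance of `a + c * x + r`. -/
lemma variance_affine_add (a c : ℝ) {f x r : ℕ → ℝ} (hf : ∀ j, f j = a + c * x j + r j)
    (hx : binomialMean θ n x = 0) :
    binomialMean θ n (fun j => f j ^ 2) - binomialMean θ n f ^ 2 =
      c ^ 2 * binomialMean θ n (fun j => x j ^ 2) +
        2 * c * binomialMean θ n (fun j => x j * r j) +
        (binomialMean θ n (fun j => r j ^ 2) - binomialMean θ n r ^ 2) := by
  have h1 : binomialMean θ n f = a + binomialMean θ n r := by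
    have : f = fun j => a * 1 + (c * x j + r j) := by ext j; rw [hf]; ring
    rw [this, add, add, const_mul, const_mul, one, hx]; ring
  have h2 : (fun j => f j ^ 2) = fun j => a ^ 2 * 1 + (c ^ 2 * x j ^ 2 + (r j ^ 2 +
      (2 * a * c * x j + (2 * a * r j + 2 * c * (x j * r j))))) := by
    ext j; rw [hf]; ring
  rw [h1, h2, add, add, add, add, add, const_mul, const_mul, const_mul, const_mul, const_mul,
    one, hx]
  ring

/-- The delta method for the variance of a function of a binomial proportion. -/
theorem tendsto_mul_variance (hθ : θ ∈ Set.Icc (0 : ℝ) 1) (g : ℝ → ℝ) (c C : ℝ)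
    (hg : ∀ x ∈ Set.Icc (0 : ℝ) 1, |g x - g θ - c * (x - θ)| ≤ C * (x - θ) ^ 2) :
    Filter.Tendsto (fun n : ℕ => (n : ℝ) * (binomialMean θ n (fun j => g (j / n) ^ 2) -
      binomialMean θ n (fun j => g (j / n)) ^ 2)) Filter.atTop
      (nhds (c ^ 2 * (θ * (1 - θ)))) := by
  set s := θ * (1 - θ) with hs
  let x : ℕ → ℕ → ℝ := fun n j => (j : ℝ) / n - θ
  let r : ℕ → ℕ → ℝ := fun n j => g (j / n) - g θ - c * x n j
  have hx : ∀ n : ℕ, 0 < n → ∀ j, x n j = (n : ℝ)⁻¹ * (j - n * θ) := by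
    intro n hn j
    have : (n : ℝ) ≠ 0 := by positivity
    simp only [x]; field_simp
  have hx1 : ∀ n : ℕ, 0 < n → binomialMean θ n (x n) = 0 := by
    intro n hn
    rw [funext (hx n hn), const_mul, centralMoment_one, mul_zero]
  have hx2 : ∀ n : ℕ, 0 < n → binomialMean θ n (fun j => x n j ^ 2) = s / n := by
    intro n hn
    have : (n : ℝ) ≠ 0 := by positivity
    simp only [hx n hn, mul_pow]
    rw [const_mul, centralMoment_two]; field_simp; rw [hs]
  have hr2 : ∀ n : ℕ, 0 < n → binomialMean θ n (fun j => r n j ^ 2) ≤ C ^ 2 / n ^ 2 := by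
    intro n hn
    have hn0 : (0 : ℝ) < n := by positivity
    calc binomialMean θ n (fun j => r n j ^ 2)
        ≤ binomialMean θ n (fun j => C ^ 2 * (n : ℝ)⁻¹ ^ 4 * (j - n * θ) ^ 4) := by
          refine mono hθ fun j hj => ?_
          have hj' : (j : ℝ) / n ∈ Set.Icc (0 : ℝ) 1 :=
            ⟨by positivity, (div_le_one hn0).mpr (by exact_mod_cast hj)⟩
          calc r n j ^ 2 = |r n j| ^ 2 := (sq_abs _).symm
            _ ≤ (C * x n j ^ 2) ^ 2 := pow_le_pow_left₀ (abs_nonneg _) (hg _ hj') 2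
            _ = _ := by rw [hx n hn]; ring
      _ ≤ C ^ 2 * (n : ℝ)⁻¹ ^ 4 * n ^ 2 := by
          rw [const_mul]
          exact mul_le_mul_of_nonneg_left (centralMoment_four_le hθ n) (by positivity)
      _ = C ^ 2 / n ^ 2 := by field_simp
  have hlim : Filter.Tendsto (fun n : ℕ => (n : ℝ)⁻¹) Filter.atTop (nhds 0) :=
    tendsto_inv_atTop_nhds_zero_nat
  have hcross : Filter.Tendsto (fun n : ℕ => (n : ℝ) * binomialMean θ n
      (fun j => x n j * r n j)) Filter.atTop (nhds 0) := by
    have hb : Filter.Tendsto (fun n : ℕ => √(s * C ^ 2 * (n : ℝ)⁻¹)) Filter.atTop (nhds 0) := by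
      simpa using (hlim.const_mul (s * C ^ 2)).sqrt
    refine squeeze_zero_norm' ?_ hb
    filter_upwards [Filter.eventually_gt_atTop 0] with n hn
    have hn0 : (0 : ℝ) < n := by positivity
    refine Real.abs_le_sqrt ?_
    have h := mul_sq_le (n := n) hθ (x n) (r n)
    rw [hx2 n hn] at h
    have hsn : 0 ≤ s / n := div_nonneg (mul_nonneg hθ.1 (sub_nonneg.mpr hθ.2)) hn0.le
    calc _ = (n : ℝ) ^ 2 * binomialMean θ n (fun j => x n j * r n j) ^ 2 := by ring
      _ ≤ (n : ℝ) ^ 2 * (s / n * (C ^ 2 / n ^ 2)) := by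
        refine mul_le_mul_of_nonneg_left (h.trans ?_) (by positivity)
        exact mul_le_mul_of_nonneg_left (hr2 n hn) hsn
      _ = _ := by field_simp
  have hrem : Filter.Tendsto (fun n : ℕ => (n : ℝ) * (binomialMean θ n (fun j => r n j ^ 2) -
      binomialMean θ n (r n) ^ 2)) Filter.atTop (nhds 0) := by
    have hb : Filter.Tendsto (fun n : ℕ => C ^ 2 * (n : ℝ)⁻¹) Filter.atTop (nhds 0) := by
      simpa using hlim.const_mul (C ^ 2)
    refine squeeze_zero' ?_ ?_ hb
    · exact Filter.Eventually.of_forall fun n =>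
        mul_nonneg (Nat.cast_nonneg n) (sub_nonneg.mpr (sq_le hθ _))
    · filter_upwards [Filter.eventually_gt_atTop 0] with n hn
      have hn0 : (0 : ℝ) < n := by positivity
      calc _ ≤ (n : ℝ) * (C ^ 2 / n ^ 2) :=
            mul_le_mul_of_nonneg_left
              ((sub_le_self _ (sq_nonneg _)).trans (hr2 n hn)) hn0.le
        _ = _ := by field_simp
  have hsum := ((hcross.const_mul (2 * c)).add hrem).const_add (c ^ 2 * s)
  simp only [mul_zero, add_zero] at hsum
  refine hsum.congr' ?_
  filter_upwards [Filter.eventually_gt_atTop 0] with n hn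
  have hn0 : (n : ℝ) ≠ 0 := by positivity
  rw [variance_affine_add (f := fun j => g (j / n)) (g θ) c (x := x n) (r := r n)
    (fun j => by simp only [r]; ring) (hx1 n hn), hx2 n hn]
  field_simp
  ring

end binomialMean

/-- Second-order remainder of a `k`-th root, in terms of the roots themselves. -/
lemma abs_root_remainder_le (k : ℕ) (hk : 0 < k) {q y : ℝ} (hq : q ∈ Set.Ioc (0 : ℝ) 1)
    (hy : y ∈ Set.Icc (0 : ℝ) 1) :
    |(q - y) - (k * q ^ (k - 1))⁻¹ * (q ^ k - y ^ k)| ≤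
      (k * q ^ (k - 1))⁻¹ * k ^ 2 * ((q ^ (k - 1))⁻¹) ^ 2 * (q ^ k - y ^ k) ^ 2 := by
  obtain ⟨hq0, hq1⟩ := hq
  obtain ⟨hy0, hy1⟩ := hy
  set S := ∑ i ∈ Finset.range k, q ^ i * y ^ (k - 1 - i) with hS
  have hfac : q ^ k - y ^ k = S * (q - y) := (Commute.all q y).geom_sum₂_mul k |>.symm
  have hQ : 0 < q ^ (k - 1) := pow_pos hq0 _
  have hk0 : (0 : ℝ) < k := by positivity
  have hSge : q ^ (k - 1) ≤ S := by
    have := Finset.single_le_sum (f := fun i => q ^ i * y ^ (k - 1 - i))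
      (fun i _ => by positivity) (Finset.mem_range.mpr (Nat.sub_one_lt hk.ne'))
    simpa using this
  have hpow : ∀ i : ℕ, |q ^ i - y ^ i| ≤ i * |q - y| := by
    intro i
    induction i with
    | zero => simp
    | succ i ih =>
      have hqi : |q ^ i| ≤ 1 := by
        rw [abs_of_nonneg (by positivity)]; exact pow_le_one₀ hq0.le hq1
      have hya : |y| ≤ 1 := by rwa [abs_of_nonneg hy0]
      calc |q ^ (i + 1) - y ^ (i + 1)| = |q ^ i * (q - y) + y * (q ^ i - y ^ i)| := by
            congr 1; ring
        _ ≤ |q ^ i| * |q - y| + |y| * |q ^ i - y ^ i| := by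
            rw [← abs_mul, ← abs_mul]; exact abs_add_le _ _
        _ ≤ 1 * |q - y| + 1 * (i * |q - y|) := by gcongr
        _ = _ := by push_cast; ring
  have hdiff : |k * q ^ (k - 1) - S| ≤ k ^ 2 * |q - y| := by
    have h1 : k * q ^ (k - 1) - S =
        ∑ i ∈ Finset.range k, q ^ i * (q ^ (k - 1 - i) - y ^ (k - 1 - i)) := by
      simp only [mul_sub, Finset.sum_sub_distrib, hS]
      congr 1
      rw [Finset.sum_congr rfl (g := fun _ => q ^ (k - 1)), Finset.sum_const, Finset.card_range,
        nsmul_eq_mul]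
      intro i hi
      rw [← pow_add]
      congr 1
      have := Finset.mem_range.mp hi
      omega
    rw [h1]
    calc _ ≤ ∑ i ∈ Finset.range k, |q ^ i * (q ^ (k - 1 - i) - y ^ (k - 1 - i))| :=
          Finset.abs_sum_le_sum_abs _ _
      _ ≤ ∑ i ∈ Finset.range k, k * |q - y| := by
          refine Finset.sum_le_sum fun i _ => ?_
          rw [abs_mul, abs_of_nonneg (pow_nonneg hq0.le i)]
          calc q ^ i * |q ^ (k - 1 - i) - y ^ (k - 1 - i)|
              ≤ 1 * (((k - 1 - i : ℕ) : ℝ) * |q - y|) := by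
                gcongr
                · exact pow_le_one₀ hq0.le hq1
                · exact hpow _
            _ ≤ k * |q - y| := by
                rw [one_mul]
                gcongr
                omega
      _ = _ := by rw [Finset.sum_const, Finset.card_range, nsmul_eq_mul]; ring
  have hqy : |q - y| ≤ (q ^ (k - 1))⁻¹ * |q ^ k - y ^ k| := by
    rw [hfac, abs_mul, abs_of_pos (hQ.trans_le hSge), inv_mul_eq_div, le_div_iff₀ hQ, mul_comm]
    gcongr
  have heq : (q - y) - (k * q ^ (k - 1))⁻¹ * (q ^ k - y ^ k) =
      (k * q ^ (k - 1))⁻¹ * ((k * q ^ (k - 1) - S) * (q - y)) := by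
    rw [hfac]; field_simp
  rw [heq, abs_mul, abs_mul, abs_of_pos (by positivity : (0 : ℝ) < (k * q ^ (k - 1))⁻¹)]
  calc _ ≤ (k * q ^ (k - 1))⁻¹ * (k ^ 2 * |q - y| * |q - y|) := by gcongr
    _ = (k * q ^ (k - 1))⁻¹ * k ^ 2 * |q - y| ^ 2 := by ring
    _ ≤ (k * q ^ (k - 1))⁻¹ * k ^ 2 * ((q ^ (k - 1))⁻¹ * |q ^ k - y ^ k|) ^ 2 := by gcongr
    _ = _ := by rw [mul_pow, sq_abs]; ring

/-- The asymptotic variance expansion of the group-testing MLE: n·Var(p̂_{n,k}) → v_k(q),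
where v_k(q) = q²(q^(-k) - 1)/k². -/
theorem stmt_12 (k : ℕ) (hk : 0 < k) (p : ℝ) (hp : p ∈ Set.Ioo (0 : ℝ) 1)
    (q θ : ℝ) (hq : q = 1 - p) (hθ : θ = 1 - q ^ k)
    (g : ℝ → ℝ) (hg : g = fun x => 1 - (1 - x) ^ ((1 : ℝ) / k))
    (V : ℕ → ℝ)
    (hV : ∀ n, V n =
      (∑ j ∈ Finset.range (n + 1),
        (n.choose j : ℝ) * θ ^ j * (1 - θ) ^ (n - j) * g ((j : ℝ) / n) ^ 2) -
      (∑ j ∈ Finset.range (n + 1),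
        (n.choose j : ℝ) * θ ^ j * (1 - θ) ^ (n - j) * g ((j : ℝ) / n)) ^ 2)
    (v : ℝ) (hv : v = q ^ 2 * (q ^ (-(k : ℝ)) - 1) / k ^ 2) :
    Filter.Tendsto (fun n : ℕ => (n : ℝ) * V n) Filter.atTop (nhds v) := by
  obtain ⟨hp0, hp1⟩ := hp
  have hq0 : 0 < q := by linarith
  have hq1 : q ≤ 1 := by linarith
  have hk0 : (k : ℝ) ≠ 0 := by positivity
  have hqk : q ^ k ≤ 1 := pow_le_one₀ hq0.le hq1
  have hqk0 : 0 < q ^ k := pow_pos hq0 k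
  have hθI : θ ∈ Set.Icc (0 : ℝ) 1 := ⟨by linarith, by linarith⟩
  have hgθ : g θ = 1 - q := by
    rw [hg, hθ]
    simp only [sub_sub_cancel, one_div]
    rw [Real.pow_rpow_inv_natCast hq0.le hk.ne']
  have hrem : ∀ x ∈ Set.Icc (0 : ℝ) 1, |g x - g θ - (k * q ^ (k - 1))⁻¹ * (x - θ)| ≤
      (k * q ^ (k - 1))⁻¹ * k ^ 2 * ((q ^ (k - 1))⁻¹) ^ 2 * (x - θ) ^ 2 := by
    intro x hx
    have hx' : 0 ≤ 1 - x := sub_nonneg.mpr hx.2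
    have hpow : ((1 - x) ^ ((1 : ℝ) / k)) ^ k = 1 - x := by
      rw [one_div, Real.rpow_inv_natCast_pow hx' hk.ne']
    have h := abs_root_remainder_le k hk ⟨hq0, hq1⟩
      (y := (1 - x) ^ ((1 : ℝ) / k)) ⟨Real.rpow_nonneg hx' _,
        Real.rpow_le_one hx' (by linarith [hx.1]) (by positivity)⟩
    rw [hpow, show q ^ k - (1 - x) = x - θ by rw [hθ]; ring] at h
    rw [hgθ, hg]
    convert h using 3
    ring
  convert binomialMean.tendsto_mul_variance hθI g _ _ hrem using 1
  · ext n; rw [hV]; rfl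
  · congr 1
    rw [hv, hθ, Real.rpow_neg hq0.le, Real.rpow_natCast]
    obtain ⟨m, rfl⟩ := Nat.exists_eq_succ_of_ne_zero hk.ne'
    simp only [Nat.succ_eq_add_one, Nat.add_sub_cancel] at *
    field_simp
    ring
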